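/- arXiv:1703.10498 — 2 statements merged into one kernel-verified Lean document; each statement's English description precedes it below -/
import Mathlib

section
/- Let M be a countable homogeneous structure with at least two elements such that M has the strong small index property, locally finite algebraicity, and acl_M({a}) = {a} for every a ∈ M. Let G = Aut(M). Then the set {G_(a) : a ∈ M} of stabilizers of single points equals the set of all H ∈ PS(M) with H ≠ G that are maximal in (PS(M) \ {G}, ⊆); consequently every abstract group automorphism F of G permutes the set {G_(a) : a ∈ M}. -/
open FirstOrder Cardinal

namespace PaperSSIP

variable {L : FirstOrder.Language} {M : Type*} [L.Structure M]

instance autGroup : Group (M ≃[L] M) where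
  mul f g := f.comp g
  one := FirstOrder.Language.Equiv.refl L M
  inv := FirstOrder.Language.Equiv.symm
  mul_assoc f g h := by ext x; rfl
  one_mul f := by ext x; rfl
  mul_one f := by ext x; rfl
  inv_mul_cancel f := by
    ext x
    exact f.symm_apply_apply x

theorem mul_apply (f g : M ≃[L] M) (x : M) : (f * g) x = f (g x) := rfl

theorem one_apply (x : M) : (1 : M ≃[L] M) x = x := rfl

theorem inv_apply (f : M ≃[L] M) (x : M) : f⁻¹ x = f.symm x := rfl

/-- The pointwise stabilizer of a set. -/
def ptStab (L : FirstOrder.Language) {M : Type*} [L.Structure M] (A : Set M) :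
    Subgroup (M ≃[L] M) where
  carrier := {g | ∀ a ∈ A, g a = a}
  one_mem' := fun a _ => rfl
  mul_mem' := by
    intro f g hf hg a ha
    rw [mul_apply, hg a ha, hf a ha]
  inv_mem' := by
    intro f hf a ha
    rw [inv_apply]
    conv_lhs => rw [← hf a ha]
    exact f.symm_apply_apply a

/-- The setwise stabilizer of a set. -/
def setStab (L : FirstOrder.Language) {M : Type*} [L.Structure M] (A : Set M) :
    Subgroup (M ≃[L] M) where
  carrier := {g | g '' A = A}
  one_mem' := by
    have : ⇑(1 : M ≃[L] M) = id := funext fun x => rfl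
    simp only [Set.mem_setOf_eq, this, Set.image_id]
  mul_mem' := by
    intro f g hf hg
    have : ⇑(f * g) = ⇑f ∘ ⇑g := rfl
    simp only [Set.mem_setOf_eq] at *
    rw [this, Set.image_comp, hg, hf]
  inv_mem' := by
    intro f hf
    have h1 : ⇑f⁻¹ ∘ ⇑f = id := funext fun x => f.symm_apply_apply x
    simp only [Set.mem_setOf_eq] at *
    calc ⇑f⁻¹ '' A = ⇑f⁻¹ '' (⇑f '' A) := by rw [hf]
    _ = A := by rw [← Set.image_comp, h1, Set.image_id]

/-- The orbit of a point under a subgroup of the automorphism group. -/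
def orbit (H : Subgroup (M ≃[L] M)) (a : M) : Set M := {b | ∃ g ∈ H, g a = b}

/-- The algebraic closure of a set: points with finite orbit under the pointwise
stabilizer of the set. -/
def acl (L : FirstOrder.Language) {M : Type*} [L.Structure M] (A : Set M) : Set M :=
  {a | (orbit (ptStab L A) a).Finite}

/-- A subgroup has small index if its index is less than the continuum. -/
def SmallIndex (H : Subgroup (M ≃[L] M)) : Prop := #((M ≃[L] M) ⧸ H) < continuum

/-- The strong small index property. -/
def HasSSIP (L : FirstOrder.Language) (M : Type*) [L.Structure M] : Prop :=
  ∀ H : Subgroup (M ≃[L] M), SmallIndex H →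
    ∃ A : Set M, A.Finite ∧ ptStab L A ≤ H ∧ H ≤ setStab L A

/-- Locally finite algebraicity. -/
def LocFinAlg (L : FirstOrder.Language) (M : Type*) [L.Structure M] : Prop :=
  ∀ A : Set M, A.Finite → (acl L A).Finite

/-- Membership in `𝐀(M)`: being (the substructure carried by) the algebraic closure
of a finite set. -/
def memA (L : FirstOrder.Language) {M : Type*} [L.Structure M]
    (S : L.Substructure M) : Prop :=
  ∃ B : Set M, B.Finite ∧ (S : Set M) = acl L B

/-- `G_(K, L')`: automorphisms of `M` whose restriction to `K` lies in `L'`. -/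
def stabIn (S : L.Substructure M) (L' : Subgroup (↥S ≃[L] ↥S)) :
    Subgroup (M ≃[L] M) where
  carrier := {f | ∃ e ∈ L', ∀ x : S, f (x : M) = (e x : M)}
  one_mem' := ⟨1, L'.one_mem, fun _ => rfl⟩
  mul_mem' := by
    rintro f g ⟨ef, hef, hf⟩ ⟨eg, heg, hg⟩
    refine ⟨ef * eg, mul_mem hef heg, fun x => ?_⟩
    rw [mul_apply, hg x]
    exact hf (eg x)
  inv_mem' := by
    rintro f ⟨e, he, hfe⟩
    refine ⟨e⁻¹, inv_mem he, fun x => ?_⟩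
    have h1 : f ((e⁻¹ x : S) : M) = (x : M) := by
      rw [hfe (e⁻¹ x)]
      exact congrArg _ (e.apply_symm_apply x)
    have h2 : f (f⁻¹ (x : M)) = (x : M) := f.apply_symm_apply x
    exact EquivLike.injective f (h2.trans h1.symm)

/-- The family `𝒮𝒮(M)` of subgroups of the form `G_(K, L')`. -/
def SS (L : FirstOrder.Language) (M : Type*) [L.Structure M] :
    Set (Subgroup (M ≃[L] M)) :=
  {H | ∃ (S : L.Substructure M) (L' : Subgroup (↥S ≃[L] ↥S)), memA L S ∧ H = stabIn S L'}

/-- The family `𝒫𝒮(M)` of pointwise stabilizers of members of `𝐀(M)`. -/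
def PS (L : FirstOrder.Language) (M : Type*) [L.Structure M] :
    Set (Subgroup (M ≃[L] M)) :=
  {H | ∃ S : L.Substructure M, memA L S ∧ H = ptStab L (S : Set M)}


/-- The natural action of the automorphism group on the structure. -/
instance autAction : MulAction (M ≃[L] M) M where
  smul g x := g x
  one_smul _ := rfl
  mul_smul _ _ _ := rfl

theorem ptStab_anti {A B : Set M} (h : A ⊆ B) : ptStab L B ≤ ptStab L A :=
  fun _ hg a ha => hg a (h ha)

theorem mem_ptStab_singleton {g : M ≃[L] M} {a : M} : g ∈ ptStab L {a} ↔ g a = a :=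
  ⟨fun h => h a rfl, fun h b hb => by rw [Set.mem_singleton_iff.1 hb, h]⟩

theorem ptStab_eq_iInf (A : Set M) : ptStab L A = ⨅ a : A, ptStab L {(a : M)} := by
  ext g
  simp only [Subgroup.mem_iInf, mem_ptStab_singleton, Subtype.forall]
  rfl

/-- A point has finite orbit under `H` iff its stabilizer has finite relative index in `H`. -/
theorem orbit_finite_iff (H : Subgroup (M ≃[L] M)) (a : M) :
    (orbit H a).Finite ↔ (ptStab L {a}).relIndex H ≠ 0 := by
  have h1 : (ptStab L {a}).subgroupOf H = MulAction.stabilizer H a := by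
    ext g
    exact mem_ptStab_singleton
  have h2 : orbit H a = MulAction.orbit H a := by
    ext b
    exact ⟨fun ⟨g, hg, h⟩ => ⟨⟨g, hg⟩, h⟩, fun ⟨g, h⟩ => ⟨g, g.2, h⟩⟩
  rw [Subgroup.relIndex, h1, MulAction.index_stabilizer, ← h2]
  exact ⟨fun h => Set.ncard_ne_zero_of_mem (a := a) ⟨1, H.one_mem, rfl⟩ h,
    Set.finite_of_ncard_ne_zero⟩

theorem relIndex_ptStab_ne_zero {H : Subgroup (M ≃[L] M)} {A : Set M} (hA : A.Finite)
    (h : ∀ a ∈ A, (orbit H a).Finite) : (ptStab L A).relIndex H ≠ 0 := by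
  have := hA.to_subtype
  rw [ptStab_eq_iInf]
  exact Subgroup.relIndex_iInf_ne_zero fun a => (orbit_finite_iff H a).1 (h a a.2)

theorem orbit_finite_of_relIndex_ptStab_ne_zero {H : Subgroup (M ≃[L] M)} {A : Set M}
    (h : (ptStab L A).relIndex H ≠ 0) {a : M} (ha : ptStab L A ≤ ptStab L {a}) :
    (orbit H a).Finite :=
  (orbit_finite_iff H a).2 (ne_zero_of_dvd_ne_zero h (Subgroup.relIndex_dvd_of_le_left H ha))

theorem subset_acl (A : Set M) : A ⊆ acl L A := fun a ha =>
  (Set.finite_singleton a).subset fun _ ⟨_, hg, h⟩ => h.symm.trans (hg a ha)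

/-- The algebraic closure of a set, as a substructure. -/
def aclSubstructure (L : FirstOrder.Language) {M : Type*} [L.Structure M] (A : Set M) :
    L.Substructure M where
  carrier := acl L A
  fun_mem f x hx := by
    refine orbit_finite_of_relIndex_ptStab_ne_zero (A := Set.range x)
      (relIndex_ptStab_ne_zero (Set.finite_range x) ?_) fun g hg => mem_ptStab_singleton.2 ?_
    · rintro _ ⟨i, rfl⟩
      exact hx i
    · rw [g.map_fun]
      exact congrArg _ (funext fun i => hg _ ⟨i, rfl⟩)

theorem ptStab_acl_mem_PS {A : Set M} (hA : A.Finite) : ptStab L (acl L A) ∈ PS L M :=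
  ⟨aclSubstructure L A, ⟨A, hA, rfl⟩, rfl⟩

theorem smallIndex_ptStab [Countable M] {A : Set M} (hA : A.Finite) :
    SmallIndex (ptStab L A) := by
  have := hA.to_subtype
  have hinj : Function.Injective (Quotient.lift (fun (g : M ≃[L] M) (a : A) => g a)
      (fun g h hgh => funext fun a => by
        have := QuotientGroup.leftRel_apply.1 hgh a a.2
        exact ((g.apply_symm_apply _).symm.trans (congrArg g this)).symm) :
      (M ≃[L] M) ⧸ ptStab L A → A → M) := by
    rintro ⟨g⟩ ⟨h⟩ hgh
    refine QuotientGroup.eq.2 fun a ha => ?_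
    exact (congrArg g.symm (congrFun hgh ⟨a, ha⟩).symm).trans (g.symm_apply_apply a)
  have := hinj.countable
  exact (Cardinal.mk_le_aleph0).trans_lt Cardinal.aleph0_lt_continuum

theorem SmallIndex.of_relIndex_ne_zero {H K : Subgroup (M ≃[L] M)} (hH : SmallIndex H)
    (hKH : K ≤ H) (h : K.relIndex H ≠ 0) : SmallIndex K := by
  have : Finite (H ⧸ K.subgroupOf H) := Subgroup.index_ne_zero_iff_finite.1 h
  rw [SmallIndex, Cardinal.mk_congr (Subgroup.quotientEquivProdOfLE hKH), Cardinal.mk_prod,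
    Cardinal.lift_id, Cardinal.lift_id]
  exact Cardinal.mul_lt_of_lt Cardinal.aleph0_le_continuum hH
    ((Cardinal.lt_aleph0_of_finite _).trans Cardinal.aleph0_lt_continuum)

theorem SmallIndex.map {H : Subgroup (M ≃[L] M)} (hH : SmallIndex H)
    (F : MulAut (M ≃[L] M)) : SmallIndex (H.map F.toMonoidHom) := by
  refine lt_of_le_of_lt (Cardinal.mk_le_of_surjective
    (f := Quotient.map' (s₁ := QuotientGroup.leftRel H)
      (s₂ := QuotientGroup.leftRel (H.map F.toMonoidHom)) F fun g h hgh => ?_) ?_) hH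
  · rw [QuotientGroup.leftRel_apply] at hgh ⊢
    exact ⟨_, hgh, by simp⟩
  · rintro ⟨g⟩
    exact ⟨Quotient.mk'' (F.symm g), congrArg Quotient.mk'' (F.apply_symm_apply g)⟩

/-- The members of `PS L M` are the subgroups of small index without proper subgroups of
finite index; this description is purely group-theoretic. -/
theorem mem_PS_iff [Countable M] (hssip : HasSSIP L M) (hlf : LocFinAlg L M)
    {H : Subgroup (M ≃[L] M)} :
    H ∈ PS L M ↔ SmallIndex H ∧ ∀ K ≤ H, K.relIndex H ≠ 0 → K = H := by
  constructor
  · rintro ⟨S, ⟨B, hB, hS⟩, rfl⟩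
    rw [hS]
    have hsmall : SmallIndex (ptStab L (acl L B)) := smallIndex_ptStab (hlf B hB)
    refine ⟨hsmall, fun K hK hne => hK.antisymm ?_⟩
    obtain ⟨A, hA, hAK, hKA⟩ := hssip K (hsmall.of_relIndex_ne_zero hK hne)
    have hAK' : (ptStab L A).relIndex K ≠ 0 := relIndex_ptStab_ne_zero hA fun a ha =>
      hA.subset fun _ ⟨g, hg, h⟩ => hKA hg ▸ ⟨a, ha, h⟩
    have hAB : (ptStab L A).relIndex (ptStab L B) ≠ 0 :=
      Subgroup.relIndex_ne_zero_trans (Subgroup.relIndex_ne_zero_trans hAK' hne)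
        (relIndex_ptStab_ne_zero (hlf B hB) fun _ ha => ha)
    exact (ptStab_anti fun a ha => orbit_finite_of_relIndex_ptStab_ne_zero hAB
      (ptStab_anti (Set.singleton_subset_iff.2 ha))).trans hAK
  · rintro ⟨hsmall, hmin⟩
    obtain ⟨A, hA, hAH, hHA⟩ := hssip H hsmall
    obtain rfl : ptStab L A = H := hmin _ hAH <| relIndex_ptStab_ne_zero hA fun a ha =>
      hA.subset fun _ ⟨g, hg, h⟩ => hHA hg ▸ ⟨a, ha, h⟩
    rw [← hmin _ (ptStab_anti (subset_acl A)) (relIndex_ptStab_ne_zero (hlf A hA) fun _ ha => ha)]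
    exact ptStab_acl_mem_PS hA

theorem map_mem_PS [Countable M] (hssip : HasSSIP L M) (hlf : LocFinAlg L M)
    {H : Subgroup (M ≃[L] M)} (hH : H ∈ PS L M) (F : MulAut (M ≃[L] M)) :
    H.map F.toMonoidHom ∈ PS L M := by
  rw [mem_PS_iff hssip hlf] at hH ⊢
  refine ⟨hH.1.map F, fun K hK hne => ?_⟩
  rw [← hH.2 (K.comap F.toMonoidHom) ?_ (by rwa [Subgroup.relIndex_comap])]
  · exact (Subgroup.map_comap_eq_self_of_surjective F.surjective K).symm
  · exact (Subgroup.comap_mono hK).trans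
      (Subgroup.comap_map_eq_self_of_injective F.injective H).le

theorem ptStab_singleton_ne_top [Nontrivial M] (h1 : ∀ a : M, acl L {a} = {a}) (a : M) :
    ptStab L {a} ≠ ⊤ := by
  intro h
  obtain ⟨b, hb⟩ := exists_ne a
  have : a ∈ acl L {b} := (Set.finite_singleton a).subset fun _ ⟨g, _, hg⟩ =>
    hg.symm.trans (mem_ptStab_singleton.1 (h ▸ Subgroup.mem_top g : g ∈ ptStab L {a}))
  rw [h1] at this
  exact hb this.symm

theorem exists_ptStab_le_of_ne_top {A : Set M} (h : ptStab L A ≠ ⊤) :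
    ∃ a ∈ A, ptStab L A ≤ ptStab L {a} := by
  obtain rfl | ⟨a, ha⟩ := A.eq_empty_or_nonempty
  · exact absurd (eq_top_iff.2 fun g _ a ha => ha.elim) h
  · exact ⟨a, ha, ptStab_anti (Set.singleton_subset_iff.2 ha)⟩

theorem ptStab_singleton_mem_PS (h1 : ∀ a : M, acl L {a} = {a}) (a : M) :
    ptStab L {a} ∈ PS L M := by
  simpa only [h1] using ptStab_acl_mem_PS (L := L) (Set.finite_singleton a)

theorem exists_eq_ptStab_singleton_iff [Nontrivial M] (h1 : ∀ a : M, acl L {a} = {a})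
    (H : Subgroup (M ≃[L] M)) :
    (∃ a : M, H = ptStab L {a}) ↔
      H ∈ PS L M ∧ H ≠ ⊤ ∧ ∀ H' ∈ PS L M, H' ≠ ⊤ → H ≤ H' → H' = H := by
  constructor
  · rintro ⟨a, rfl⟩
    refine ⟨ptStab_singleton_mem_PS h1 a, ptStab_singleton_ne_top h1 a, ?_⟩
    rintro _ ⟨S, _, rfl⟩ hne hle
    obtain ⟨b, hb, hle'⟩ := exists_ptStab_le_of_ne_top hne
    have : b ∈ acl L {a} := (Set.finite_singleton b).subset fun _ ⟨g, hg, h⟩ =>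
      h.symm.trans (hle hg b hb)
    rw [h1, Set.mem_singleton_iff] at this
    exact (this ▸ hle').antisymm hle
  · rintro ⟨⟨S, _, rfl⟩, hne, hmax⟩
    obtain ⟨a, _, hle⟩ := exists_ptStab_le_of_ne_top hne
    exact ⟨a, (hmax _ (ptStab_singleton_mem_PS h1 a) (ptStab_singleton_ne_top h1 a) hle).symm⟩

/-- For `M ∈ 𝐊₌` (with at least two elements), the single-point stabilizers
are exactly the members of `𝒫𝒮(M)` different from `G` that are maximal in
`(𝒫𝒮(M) \ {G}, ⊆)`; consequently every abstract group automorphism of `Aut(M)` permutes the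
single-point stabilizers. -/
theorem statement_13 {L : FirstOrder.Language} {M : Type*} [L.Structure M]
    [Countable M] [Countable L.Symbols] [Nontrivial M]
    (hhom : L.IsUltrahomogeneous M) (hssip : HasSSIP L M) (hlf : LocFinAlg L M)
    (h1 : ∀ a : M, acl L {a} = {a}) :
    {H : Subgroup (M ≃[L] M) | ∃ a : M, H = ptStab L {a}} =
        {H | H ∈ PS L M ∧ H ≠ ⊤ ∧ ∀ H' ∈ PS L M, H' ≠ ⊤ → H ≤ H' → H' = H} ∧
      ∀ (F : MulAut (M ≃[L] M)) (a : M),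
        ∃ b : M, (ptStab L ({a} : Set M)).map F.toMonoidHom = ptStab L ({b} : Set M) := by
  refine ⟨Set.ext (exists_eq_ptStab_singleton_iff h1), fun F a => ?_⟩
  obtain ⟨hmem, hne, hmax⟩ := (exists_eq_ptStab_singleton_iff h1 _).1 ⟨a, rfl⟩
  refine (exists_eq_ptStab_singleton_iff h1 _).2 ⟨map_mem_PS hssip hlf hmem F, fun h => hne ?_,
    fun H' hH' hne' hle => ?_⟩
  · exact (map_eq_top_iff F.mapSubgroup).1 h
  · have hle' : ptStab L {a} ≤ F.mapSubgroup.symm H' := F.mapSubgroup.le_symm_apply.2 hle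
    have := hmax (F.mapSubgroup.symm H') (map_mem_PS hssip hlf hH' F.symm)
      (fun h => hne' ((map_eq_top_iff F.mapSubgroup.symm).1 h)) hle'
    exact F.mapSubgroup.symm_apply_eq.1 this

end PaperSSIP
end

section
/- Let M be a countable homogeneous structure with the strong small index property and locally finite algebraicity, and G = Aut(M). If (K₁, L₁), (K₂, L₂) ∈ EA(M) and G_(K₁,L₁) ⊆ G_(K₂,L₂), then K₂ ⊆ K₁. -/
open FirstOrder Cardinal

namespace PaperSSIP

variable {L : FirstOrder.Language} {M : Type*} [L.Structure M]

theorem apply_mem_acl {B : Set M} {g : M ≃[L] M} (hg : g ∈ ptStab L B) {a : M}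
    (ha : a ∈ acl L B) : g a ∈ acl L B := by
  refine Set.Finite.subset ha ?_
  rintro _ ⟨k, hk, rfl⟩
  exact ⟨k * g, mul_mem hk hg, rfl⟩

/-- Algebraic closure is idempotent when it is finite. -/
theorem acl_acl_subset {B : Set M} (hfin : (acl L B).Finite) :
    acl L (acl L B) ⊆ acl L B := by
  intro x hx
  have : Finite (acl L B) := hfin
  let r : ptStab L B → (acl L B → acl L B) := fun g a => ⟨g.1 a, apply_mem_acl g.2 a.2⟩
  have hcover : orbit (ptStab L B) x ⊆
      ⋃ f : Set.range r, f.2.choose.1 '' orbit (ptStab L (acl L B)) x := by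
    rintro _ ⟨g, hg, rfl⟩
    let f : Set.range r := ⟨r ⟨g, hg⟩, ⟨g, hg⟩, rfl⟩
    have hf : r f.2.choose = r ⟨g, hg⟩ := f.2.choose_spec
    refine Set.mem_iUnion.2 ⟨f, (f.2.choose.1⁻¹ * g) x, ⟨_, fun a ha => ?_, rfl⟩,
      f.2.choose.1.apply_symm_apply (g x)⟩
    have hga : f.2.choose.1 a = g a := congrArg Subtype.val (congrFun hf ⟨a, ha⟩)
    rw [mul_apply, ← hga]
    exact f.2.choose.1.symm_apply_apply a
  exact (Set.finite_iUnion fun f => Set.Finite.image _ hx).subset hcover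

theorem ptStab_le_stabIn (S : L.Substructure M) (L' : Subgroup (↥S ≃[L] ↥S)) :
    ptStab L (S : Set M) ≤ stabIn S L' :=
  fun _ hg => ⟨1, L'.one_mem, fun x => hg x x.2⟩

/-- If `(K₁, L₁), (K₂, L₂) ∈ 𝐄𝐀(M)` and `G_(K₁,L₁) ⊆ G_(K₂,L₂)`,
then `K₂ ⊆ K₁`. -/
theorem statement_15 {L : FirstOrder.Language} {M : Type*} [L.Structure M]
    [Countable M] [Countable L.Symbols]
    (hhom : L.IsUltrahomogeneous M) (hssip : HasSSIP L M) (hlf : LocFinAlg L M)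
    {S₁ S₂ : L.Substructure M} (L₁ : Subgroup (↥S₁ ≃[L] ↥S₁)) (L₂ : Subgroup (↥S₂ ≃[L] ↥S₂))
    (h₁ : memA L S₁) (h₂ : memA L S₂)
    (h : stabIn S₁ L₁ ≤ stabIn S₂ L₂) :
    (S₂ : Set M) ⊆ (S₁ : Set M) := by
  obtain ⟨B₁, hB₁, hS₁⟩ := h₁
  obtain ⟨B₂, hB₂, hS₂⟩ := h₂
  intro x hx
  rw [hS₁]
  apply acl_acl_subset (hlf B₁ hB₁)
  refine (hS₂ ▸ hlf B₂ hB₂ : (S₂ : Set M).Finite).subset ?_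
  rintro _ ⟨g, hg, rfl⟩
  rw [← hS₁] at hg
  obtain ⟨e, -, he⟩ := h (ptStab_le_stabIn S₁ L₁ hg)
  rw [he ⟨x, hx⟩]
  exact (e ⟨x, hx⟩).2

end PaperSSIP
end
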